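/- There exists an absolute constant C such that the following holds. Let F be a finite field, d ≥ 0 an integer, and ε a real number with ε ≥ C·d/|F|. Let (r_i)_{i ∈ F} and (c_j)_{j ∈ F} be families of univariate polynomials over F of degree at most d such that the fraction of pairs (i,j) ∈ F × F with r_i(j) ≠ c_j(i) is at most 1/4 - ε. Then there exists a bivariate polynomial Q(X,Y) over F of degree at most d in each variable such that |{i ∈ F : the polynomial r_i(Y) is not equal to Q(i,Y)}| ≤ |F|/4 and |{j ∈ F : the polynomial c_j(X) is not equal to Q(X,j)}| ≤ |F|/4. -/

import Mathlib

section
open Polynomial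
open scoped Polynomial.Bivariate

variable {F : Type*} [Field F]

theorem coeff_coeff_swap (p : F[X][Y]) (k l : ℕ) :
    ((Bivariate.swap p).coeff k).coeff l = (p.coeff l).coeff k := by
  induction p using Polynomial.induction_on' with
  | add p q hp hq => simp only [map_add, coeff_add, hp, hq]
  | monomial n f =>
    induction f using Polynomial.induction_on' with
    | add f g hf hg => simp only [map_add, coeff_add, hf, hg]
    | monomial m a =>
      rw [Bivariate.swap_monomial_monomial]
      simp only [coeff_monomial]
      split_ifs <;> simp_all [coeff_monomial]

theorem map_eval_swap (p : F[X][Y]) (x : F) :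
    (Bivariate.swap p).map (evalRingHom x) = p.eval (C x) := by
  induction p using Polynomial.induction_on' with
  | add p q hp hq => simp only [map_add, Polynomial.map_add, eval_add, hp, hq]
  | monomial n f =>
    induction f using Polynomial.induction_on' with
    | add f g hf hg => simp only [map_add, Polynomial.map_add, eval_add, hf, hg]
    | monomial m a =>
      rw [Bivariate.swap_monomial_monomial, map_monomial, eval_monomial,
        ← C_mul_X_pow_eq_monomial, ← C_mul_X_pow_eq_monomial]
      simp [mul_right_comm, C_mul_X_pow_eq_monomial]

theorem natDegree_coeff_le_natDegree_swap (p : F[X][Y]) (k : ℕ) :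
    (p.coeff k).natDegree ≤ (Bivariate.swap p).natDegree := by
  refine natDegree_le_iff_coeff_eq_zero.2 fun m hm => ?_
  rw [← coeff_coeff_swap, coeff_eq_zero_of_natDegree_lt hm, coeff_zero]

theorem card_filter_map_eval_eq_zero_le [Fintype F] [DecidableEq F] {p : F[X][Y]} (hp : p ≠ 0) :
    (Finset.univ.filter fun x : F => p.map (evalRingHom x) = 0).card ≤
      (Bivariate.swap p).natDegree := by
  obtain ⟨k, hk⟩ : ∃ k, p.coeff k ≠ 0 := by
    by_contra! h
    exact hp (Polynomial.ext (by simpa using h))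
  refine le_trans ?_ (natDegree_coeff_le_natDegree_swap p k)
  refine card_le_degree_of_subset_roots (p := p.coeff k) fun x hx => ?_
  have hx' : p.map (evalRingHom x) = 0 := by simpa using hx
  have := congrArg (fun q => q.coeff k) hx'
  rw [mem_roots hk]
  simpa [coeff_map] using this

theorem X_sub_C_dvd_coeff_of_map_eval_eq_zero {p : F[X][Y]} {x : F}
    (h : p.map (evalRingHom x) = 0) (k : ℕ) : X - C x ∣ p.coeff k := by
  rw [dvd_iff_isRoot]
  have := congrArg (fun q => q.coeff k) h
  simpa [coeff_map] using this

theorem Matrix.natDegree_det_le_sum {R n : Type*} [CommRing R] [Fintype n] [DecidableEq n]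
    (M : Matrix n n R[X]) (w : n → ℕ) (h : ∀ s t, (M s t).natDegree ≤ w s) :
    M.det.natDegree ≤ ∑ s, w s := by
  rw [← Matrix.det_transpose, Matrix.det_apply]
  refine natDegree_sum_le_of_forall_le _ _ fun σ _ => ?_
  refine (natDegree_smul_le _ _).trans ((natDegree_prod_le _ _).trans ?_)
  exact Finset.sum_le_sum fun s _ => h _ _

theorem Matrix.prod_dvd_det_of_dvd_row {R n : Type*} [CommRing R] [Fintype n] [DecidableEq n]
    (M : Matrix n n R) (w : n → R) (h : ∀ s t, w s ∣ M s t) :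
    ∏ s, w s ∣ M.det := by
  choose N hN using h
  have : M = Matrix.of fun s t => w s * N s t := by ext s t; exact hN s t
  rw [this]
  exact ⟨_, Matrix.det_mul_column w N⟩

/-- The Sylvester matrix of `p` and `q`, with `m` rows of shifts of `p` and `n` rows of shifts
of `q`. -/
noncomputable def shiftMatrix {R : Type*} [CommRing R] (p q : R[X]) (m n : ℕ) :
    Matrix (Fin m ⊕ Fin n) (Fin m ⊕ Fin n) R :=
  fun s t => (Sum.elim (fun k : Fin m => X ^ (k : ℕ) * p)
    (fun k : Fin n => X ^ (k : ℕ) * q) s).coeff (finSumFinEquiv t)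

theorem det_shiftMatrix_ne_zero {R : Type*} [CommRing R] [IsDomain R] [DecompositionMonoid R[X]]
    {p q : R[X]} {m n : ℕ} (hp : p ≠ 0) (hpn : p.natDegree = n) (hq : q.natDegree ≤ m)
    (hpq : IsRelPrime p q) : (shiftMatrix p q m n).det ≠ 0 := by
  intro hdet
  obtain ⟨v, hv, hM⟩ := Matrix.exists_vecMul_eq_zero_iff.2 hdet
  set U : R[X] := ∑ k : Fin m, C (v (Sum.inl k)) * X ^ (k : ℕ) with hU
  set V : R[X] := ∑ k : Fin n, C (v (Sum.inr k)) * X ^ (k : ℕ) with hV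
  have hUdeg : U.degree < m := degree_sum_fin_lt _
  have hVdeg : V.degree < n := degree_sum_fin_lt _
  have hsum : U * p + V * q = 0 := by
    ext j
    rcases lt_or_ge j (m + n) with hj | hj
    · have := congrFun hM (finSumFinEquiv.symm ⟨j, hj⟩)
      simpa [Matrix.vecMul, dotProduct, shiftMatrix, hU, hV, Finset.sum_mul, mul_assoc,
        finsetSum_coeff, coeff_C_mul] using this
    · refine coeff_eq_zero_of_degree_lt (lt_of_lt_of_le ?_ (Nat.cast_le.2 hj))
      have hpd : p.degree ≤ n := degree_le_of_natDegree_le hpn.le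
      have hqd : q.degree ≤ m := degree_le_of_natDegree_le hq
      refine lt_of_le_of_lt (degree_add_le _ _) (max_lt ?_ ?_)
      · rw [degree_mul, Nat.cast_add]
        by_cases h0 : U = 0
        · simp [h0]
        · have h1 := (natDegree_lt_iff_degree_lt h0).2 hUdeg
          rw [degree_eq_natDegree h0, degree_eq_natDegree hp]
          exact_mod_cast (by omega : U.natDegree + p.natDegree < m + n)
      · by_cases h0 : V * q = 0
        · rw [h0, degree_zero]; exact WithBot.bot_lt_coe (m + n)
        · have h1 := (natDegree_lt_iff_degree_lt (left_ne_zero_of_mul h0)).2 hVdeg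
          rw [degree_eq_natDegree h0, natDegree_mul (left_ne_zero_of_mul h0)
            (right_ne_zero_of_mul h0)]
          exact_mod_cast (by omega : V.natDegree + q.natDegree < m + n)
  have hdvd : p ∣ V * q := ⟨-U, by linear_combination hsum⟩
  have hV0 : V = 0 := by
    by_contra h0
    have h1 := natDegree_le_of_dvd (hpq.dvd_of_dvd_mul_right hdvd) h0
    have h2 := (natDegree_lt_iff_degree_lt h0).2 hVdeg
    omega
  have hU0 : U = 0 := by
    rw [hV0, zero_mul, add_zero] at hsum
    exact (mul_eq_zero.1 hsum).resolve_right hp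
  refine hv (funext fun s => ?_)
  rcases s with k | k
  · have := congrArg (fun f => f.coeff (k : ℕ)) hU0
    simpa [hU, finsetSum_coeff, coeff_C_mul, coeff_X_pow, Fin.val_inj] using this
  · have := congrArg (fun f => f.coeff (k : ℕ)) hV0
    simpa [hV, finsetSum_coeff, coeff_C_mul, coeff_X_pow, Fin.val_inj] using this

theorem X_sub_C_pow_dvd_det_shiftMatrix {p q : F[X][Y]} {m n d : ℕ} {x : F} {r : F[X]}
    (hm : n + d ≤ m)
    (hr : r.natDegree ≤ d) (h : q.map (evalRingHom x) = p.map (evalRingHom x) * r) :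
    (X - C x) ^ n ∣ (shiftMatrix p q m n).det := by
  set T : Matrix (Fin m ⊕ Fin n) (Fin m ⊕ Fin n) F[X] :=
    Matrix.fromBlocks 1 0 (Matrix.of fun k l => -C ((X ^ (k : ℕ) * r).coeff l)) 1 with hT
  have hTdet : T.det = 1 := by simp [hT]
  have hentry (k : Fin n) (t) : (T * shiftMatrix p q m n) (Sum.inr k) t =
      (X ^ (k : ℕ) * (q - p * r.map C)).coeff (finSumFinEquiv t : Fin (m + n)) := by
    have hsum : X ^ (k : ℕ) * r.map C =
        ∑ l : Fin m, C (C ((X ^ (k : ℕ) * r).coeff l)) * X ^ (l : ℕ) := by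
      have h1 : (X ^ (k : ℕ) * r).natDegree < m := by
        refine natDegree_mul_le.trans_lt ?_
        have := k.2
        simp
        omega
      have h2 := (X ^ (k : ℕ) * r).as_sum_range' m h1
      rw [Finset.sum_range] at h2
      have h3 := congrArg (Polynomial.map (C : F →+* F[X])) h2
      simpa [Polynomial.map_sum, ← C_mul_X_pow_eq_monomial] using h3
    have : X ^ (k : ℕ) * (q - p * r.map C) =
        X ^ (k : ℕ) * q - ∑ l : Fin m, C (C ((X ^ (k : ℕ) * r).coeff l)) * (X ^ (l : ℕ) * p) := by
      rw [mul_sub, mul_comm p, ← mul_assoc, hsum, Finset.sum_mul]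
      simp only [mul_assoc]
    rw [this]
    simp [Matrix.mul_apply, hT, shiftMatrix, Matrix.one_apply, coeff_C_mul,
      sub_eq_neg_add]
  have hdvd := Matrix.prod_dvd_det_of_dvd_row (T * shiftMatrix p q m n)
    (Sum.elim (fun _ => 1) (fun _ => X - C x)) (by
      rintro (k | k) t
      · simp
      · rw [hentry]
        refine X_sub_C_dvd_coeff_of_map_eval_eq_zero ?_ _
        have hC : (r.map C).map (evalRingHom x) = r := by
          rw [Polynomial.map_map]
          have : (evalRingHom x).comp C = RingHom.id F := by ext; simp
          rw [this, Polynomial.map_id]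
        simp [h, hC])
  rw [Matrix.det_mul, hTdet, one_mul] at hdvd
  simpa using hdvd

theorem natDegree_mul_card_le_of_isRelPrime {p q : F[X][Y]} {a d : ℕ} (hp : p ≠ 0)
    (hpq : IsRelPrime p q) (hq : q.natDegree ≤ p.natDegree + d)
    (hpa : (Bivariate.swap p).natDegree ≤ a) (hqa : (Bivariate.swap q).natDegree ≤ a + d)
    (A : Finset F)
    (hA : ∀ x ∈ A, ∃ r : F[X], r.natDegree ≤ d ∧
      q.map (evalRingHom x) = p.map (evalRingHom x) * r) :
    p.natDegree * A.card ≤ (p.natDegree + d) * a + p.natDegree * (a + d) := by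
  set n := p.natDegree with hn
  set M := shiftMatrix p q (n + d) n with hM
  have hdet : M.det ≠ 0 := det_shiftMatrix_ne_zero hp hn.symm hq hpq
  have hle : M.det.natDegree ≤ (n + d) * a + n * (a + d) := by
    refine (Matrix.natDegree_det_le_sum M (Sum.elim (fun _ => a) (fun _ => a + d)) ?_).trans ?_
    · rintro (k | k) t
      · simp only [hM, shiftMatrix, Sum.elim_inl, coeff_X_pow_mul']
        split_ifs
        · exact (natDegree_coeff_le_natDegree_swap _ _).trans hpa
        · simp
      · simp only [hM, shiftMatrix, Sum.elim_inr, coeff_X_pow_mul']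
        split_ifs
        · exact (natDegree_coeff_le_natDegree_swap _ _).trans hqa
        · simp
    · simp
  have hdvd : ∏ x ∈ A, (X - C x) ^ n ∣ M.det := by
    refine Finset.prod_dvd_of_coprime (fun x _ y _ hxy => ?_) fun x hx => ?_
    · exact (isCoprime_X_sub_C_of_isUnit_sub (sub_ne_zero.2 hxy).isUnit).pow
    · obtain ⟨r, hr, h⟩ := hA x hx
      exact X_sub_C_pow_dvd_det_shiftMatrix le_rfl hr h
  have := natDegree_le_of_dvd hdvd hdet
  rw [natDegree_prod_of_monic _ _ fun x _ => (monic_X_sub_C x).pow n] at this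
  simp [natDegree_pow] at this
  linarith

theorem isRelPrime_swap {p q : F[X][Y]} (h : IsRelPrime p q) :
    IsRelPrime (Bivariate.swap p) (Bivariate.swap q) := by
  intro f hfp hfq
  have h1 := map_dvd (Bivariate.swap (R := F)) hfp
  have h2 := map_dvd (Bivariate.swap (R := F)) hfq
  rw [Bivariate.swap_swap_apply] at h1 h2
  simpa [Bivariate.swap_swap_apply] using (h h1 h2).map (Bivariate.swap (R := F))

theorem swap_ne_zero {p : F[X][Y]} (h : p ≠ 0) : Bivariate.swap p ≠ 0 := by
  simpa only [ne_eq, map_eq_zero_iff _ (Bivariate.swap (R := F)).injective] using h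

theorem natDegree_eq_zero_of_isRelPrime [Fintype F] {D p q : F[X][Y]} {d : ℕ}
    (hD : D ≠ 0) (hp : p ≠ 0) (hpq : IsRelPrime p q) (hq : q.natDegree ≤ p.natDegree + d)
    (hqs : (Bivariate.swap q).natDegree ≤ (Bivariate.swap p).natDegree + d)
    (hle : (Bivariate.swap p).natDegree ≤ p.natDegree)
    (hcard : 2 * (Bivariate.swap (D * p)).natDegree + 2 * d < Fintype.card F)
    (hrows : ∀ x : F, ∃ r : F[X], r.natDegree ≤ d ∧
      (D * q).map (evalRingHom x) = (D * p).map (evalRingHom x) * r) :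
    p.natDegree = 0 := by
  classical
  by_contra hb
  set Z := Finset.univ.filter fun x : F => D.map (evalRingHom x) = 0 with hZ
  have hZcard : Z.card ≤ (Bivariate.swap D).natDegree := card_filter_map_eval_eq_zero_le hD
  have hres := natDegree_mul_card_le_of_isRelPrime hp hpq hq le_rfl hqs Zᶜ (by
    intro x hx
    obtain ⟨r, hr, h⟩ := hrows x
    refine ⟨r, hr, ?_⟩
    have hDx : D.map (evalRingHom x) ≠ 0 := by simpa [hZ] using hx
    simp only [Polynomial.map_mul, mul_assoc] at h
    exact mul_left_cancel₀ hDx h)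
  rw [map_mul, natDegree_mul (swap_ne_zero hD) (swap_ne_zero hp)] at hcard
  have hcompl : Zᶜ.card + Z.card = Fintype.card F := Finset.card_compl_add_card Z
  have hlt : 2 * (Bivariate.swap p).natDegree + 2 * d < Zᶜ.card := by omega
  have h1 := Nat.mul_lt_mul_of_pos_left hlt (Nat.pos_of_ne_zero hb)
  have h2 := Nat.mul_le_mul_left d hle
  nlinarith

/-- The Polishchuk-Spielman divisibility criterion. -/
theorem dvd_of_rows_of_columns [Fintype F] {p q : F[X][Y]} {d : ℕ} (hp : p ≠ 0)
    (hq : q.natDegree ≤ p.natDegree + d)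
    (hqs : (Bivariate.swap q).natDegree ≤ (Bivariate.swap p).natDegree + d)
    (hcard : 2 * p.natDegree + 2 * d < Fintype.card F)
    (hcards : 2 * (Bivariate.swap p).natDegree + 2 * d < Fintype.card F)
    (hrows : ∀ x : F, ∃ r : F[X], r.natDegree ≤ d ∧
      q.map (evalRingHom x) = p.map (evalRingHom x) * r)
    (hcols : ∀ y : F, ∃ c : F[X], c.natDegree ≤ d ∧
      q.eval (C y) = p.eval (C y) * c) :
    p ∣ q := by
  obtain ⟨p', q', D, hrel, rfl, rfl⟩ := UniqueFactorizationMonoid.exists_reduced_factors p hp q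
  have hD : D ≠ 0 := left_ne_zero_of_mul hp
  have hp' : p' ≠ 0 := right_ne_zero_of_mul hp
  have hq' : q'.natDegree ≤ p'.natDegree + d := by
    rcases eq_or_ne q' 0 with rfl | h0
    · simp
    · rw [natDegree_mul hD h0, natDegree_mul hD hp'] at hq
      omega
  have hqs' : (Bivariate.swap q').natDegree ≤ (Bivariate.swap p').natDegree + d := by
    rcases eq_or_ne q' 0 with rfl | h0
    · simp
    · rw [map_mul, map_mul, natDegree_mul (swap_ne_zero hD) (swap_ne_zero h0),
        natDegree_mul (swap_ne_zero hD) (swap_ne_zero hp')] at hqs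
      omega
  have hconst : p'.natDegree = 0 ∧ (Bivariate.swap p').natDegree = 0 := by
    rcases le_total (Bivariate.swap p').natDegree p'.natDegree with hle | hle
    · have := natDegree_eq_zero_of_isRelPrime hD hp' hrel hq' hqs' hle hcards hrows
      omega
    · have := natDegree_eq_zero_of_isRelPrime (swap_ne_zero hD) (swap_ne_zero hp')
        (isRelPrime_swap hrel) hqs' (by simpa only [Bivariate.swap_swap_apply] using hq')
        (by simpa only [Bivariate.swap_swap_apply] using hle)
        (by simpa only [← map_mul, Bivariate.swap_swap_apply] using hcard)
        (fun y => by
          obtain ⟨c, hc, h⟩ := hcols y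
          exact ⟨c, hc, by simpa only [← map_mul, map_eval_swap] using h⟩)
      omega
  have hunit : IsUnit p' := by
    rw [eq_C_of_natDegree_eq_zero hconst.1] at hp' ⊢
    have h1 : (p'.coeff 0).natDegree = 0 :=
      Nat.le_zero.1 (hconst.2 ▸ natDegree_coeff_le_natDegree_swap p' 0)
    rw [eq_C_of_natDegree_eq_zero h1] at hp' ⊢
    exact ((by simpa using hp' : (p'.coeff 0).coeff 0 ≠ 0).isUnit.map C).map C
  exact mul_dvd_mul_left D hunit.dvd

theorem exists_interpolant [Fintype F] {p : F[X][Y]} {d : ℕ} {r c : F → F[X]}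
    (hr : ∀ i, (r i).natDegree ≤ d) (hc : ∀ j, (c j).natDegree ≤ d)
    (hcard : p.natDegree + d < Fintype.card F)
    (hcards : (Bivariate.swap p).natDegree + d < Fintype.card F)
    (h : ∀ i j, p.evalEval i j * (r i).eval j = p.evalEval i j * (c j).eval i) :
    ∃ q : F[X][Y], q.natDegree ≤ p.natDegree + d ∧
      (Bivariate.swap q).natDegree ≤ (Bivariate.swap p).natDegree + d ∧
      (∀ i, q.map (evalRingHom i) = p.map (evalRingHom i) * r i) ∧
      ∀ j, q.eval (C j) = p.eval (C j) * c j := by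
  classical
  obtain ⟨J, hJ⟩ := Finset.exists_subset_card_eq (s := (Finset.univ : Finset F))
    (n := p.natDegree + d + 1) (by simpa using hcard)
  replace hJ := hJ.2
  have hcol (j : F) : (p.eval (C j) * c j).natDegree ≤ (Bivariate.swap p).natDegree + d := by
    refine natDegree_mul_le.trans (add_le_add ?_ (hc j))
    rw [← map_eval_swap]
    exact natDegree_map_le
  have hrow (i : F) : (p.map (evalRingHom i) * r i).natDegree ≤ p.natDegree + d :=
    natDegree_mul_le.trans (add_le_add natDegree_map_le (hr i))
  set q : F[X][Y] := ∑ j ∈ J, (Lagrange.basis J id j).map C * C (p.eval (C j) * c j) with hqdef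
  have hq : q.natDegree ≤ p.natDegree + d := by
    refine natDegree_sum_le_of_forall_le _ _ fun j hj => ?_
    refine (natDegree_mul_C_le _ _).trans (natDegree_map_le.trans ?_)
    rw [Lagrange.natDegree_basis (Set.injOn_id _) hj, hJ, Nat.add_sub_cancel]
  have hqs : (Bivariate.swap q).natDegree ≤ (Bivariate.swap p).natDegree + d := by
    rw [hqdef, map_sum]
    refine natDegree_sum_le_of_forall_le _ _ fun j _ => ?_
    rw [map_mul, Bivariate.swap_map_C, Bivariate.swap_C]
    exact (natDegree_C_mul_le _ _).trans (natDegree_map_le.trans (hcol j))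
  have hqJ (j) (hj : j ∈ J) : q.eval (C j) = p.eval (C j) * c j := by
    rw [hqdef, eval_finsetSum, Finset.sum_eq_single_of_mem j hj]
    · have := Lagrange.eval_basis_self (v := (id : F → F)) (Set.injOn_id (J : Set F)) hj
      rw [id] at this
      rw [eval_mul, eval_C, eval_map, eval₂_at_apply, this, map_one, one_mul]
    · intro k hk hkj
      have := Lagrange.eval_basis_of_ne (v := (id : F → F)) hkj hj
      rw [id] at this
      rw [eval_mul, eval_C, eval_map, eval₂_at_apply, this, map_zero, zero_mul]
  have hrows (i : F) : q.map (evalRingHom i) = p.map (evalRingHom i) * r i := by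
    refine eq_of_natDegree_lt_card_of_eval_eq' _ _ J (fun j hj => ?_) ?_
    · rw [eval_mul, map_evalRingHom_eval, map_evalRingHom_eval, h, evalEval, hqJ j hj, eval_mul]
    · rw [hJ]
      exact Nat.lt_succ_of_le (max_le (natDegree_map_le.trans hq) (hrow i))
  refine ⟨q, hq, hqs, hrows, fun j => ?_⟩
  refine eq_of_natDegree_lt_card_of_eval_eq' _ _ Finset.univ (fun i _ => ?_) ?_
  · rw [eval_mul]
    change q.evalEval i j = p.evalEval i j * _
    rw [← h, ← map_evalRingHom_eval, hrows, eval_mul, map_evalRingHom_eval]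
  · rw [Finset.card_univ]
    refine lt_of_le_of_lt (max_le ?_ (hcol j)) hcards
    rw [← map_eval_swap]
    exact natDegree_map_le.trans hqs

theorem exists_ne_zero_evalEval_eq_zero (S : Finset (F × F)) {e : ℕ}
    (hS : S.card < (e + 1) ^ 2) :
    ∃ p : F[X][Y], p ≠ 0 ∧ p.natDegree ≤ e ∧ (Bivariate.swap p).natDegree ≤ e ∧
      ∀ z ∈ S, p.evalEval z.1 z.2 = 0 := by
  let M : Matrix S (Fin (e + 1) × Fin (e + 1)) F :=
    fun z k => z.1.1 ^ (k.2 : ℕ) * z.1.2 ^ (k.1 : ℕ)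
  have hker : LinearMap.ker M.mulVecLin ≠ ⊥ := LinearMap.ker_ne_bot_of_finrank_lt (by
    simpa [← sq] using hS)
  obtain ⟨v, hv, hv0⟩ := Submodule.exists_mem_ne_zero_of_ne_bot hker
  set p : F[X][Y] := ∑ k : Fin (e + 1),
    monomial k (∑ l : Fin (e + 1), monomial l (v (k, l))) with hp
  have hcoeff (k l : Fin (e + 1)) : (p.coeff k).coeff l = v (k, l) := by
    simp only [hp, finsetSum_coeff, coeff_monomial, Fin.val_inj, Finset.sum_ite_eq',
      Finset.mem_univ, if_true]
  refine ⟨p, ?_, ?_, ?_, fun z hz => ?_⟩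
  · intro h0
    refine hv0 (funext fun k => ?_)
    rw [← hcoeff k.1 k.2, h0]
    simp
  · exact natDegree_sum_le_of_forall_le _ _ fun k _ =>
      (natDegree_monomial_le _).trans (Nat.lt_succ_iff.1 k.2)
  · rw [hp, map_sum]
    refine natDegree_sum_le_of_forall_le _ _ fun k _ => ?_
    rw [Bivariate.swap_monomial]
    refine (natDegree_mul_C_le _ _).trans (natDegree_map_le.trans ?_)
    exact natDegree_sum_le_of_forall_le _ _ fun l _ =>
      (natDegree_monomial_le _).trans (Nat.lt_succ_iff.1 l.2)
  · have hz0 : ∑ k : Fin (e + 1) × Fin (e + 1),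
        z.1 ^ (k.2 : ℕ) * z.2 ^ (k.1 : ℕ) * v k = 0 :=
      congrFun (LinearMap.mem_ker.1 hv) ⟨z, hz⟩
    rw [← hz0, Fintype.sum_prod_type]
    simp only [hp, evalEval, eval_finsetSum, eval_mul, eval_C, eval_pow, eval_monomial,
      Finset.sum_mul]
    exact Finset.sum_congr rfl fun k _ => Finset.sum_congr rfl fun l _ => by ring

theorem aeval_equivMvPolynomial_C_X (q : F[X][Y]) (x : F) :
    MvPolynomial.aeval ![C x, X] (Bivariate.equivMvPolynomial F q) = q.map (evalRingHom x) := by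
  induction q using Polynomial.induction_on' with
  | add p q hp hq => simp only [map_add, Polynomial.map_add, hp, hq]
  | monomial n f =>
    induction f using Polynomial.induction_on' with
    | add f g hf hg => simp only [map_add, Polynomial.map_add, hf, hg]
    | monomial m a => simp [← C_mul_X_pow_eq_monomial, algebraMap_eq]

theorem aeval_equivMvPolynomial_X_C (q : F[X][Y]) (y : F) :
    MvPolynomial.aeval ![X, C y] (Bivariate.equivMvPolynomial F q) = q.eval (C y) := by
  induction q using Polynomial.induction_on' with
  | add p q hp hq => simp only [map_add, eval_add, hp, hq]
  | monomial n f =>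
    induction f using Polynomial.induction_on' with
    | add f g hf hg => simp only [map_add, eval_add, hf, hg]
    | monomial m a => simp [← C_mul_X_pow_eq_monomial, algebraMap_eq]

theorem equivMvPolynomial_eq_sum (q : F[X][Y]) :
    Bivariate.equivMvPolynomial F q = ∑ k ∈ q.support, ∑ l ∈ (q.coeff k).support,
      MvPolynomial.C ((q.coeff k).coeff l) *
        (MvPolynomial.X 0 ^ l * MvPolynomial.X 1 ^ k) := by
  conv_lhs => rw [q.as_sum_support_C_mul_X_pow]
  simp only [map_sum, map_mul, map_pow, Bivariate.equivMvPolynomial_X]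
  refine Finset.sum_congr rfl fun k _ => ?_
  conv_lhs => rw [(q.coeff k).as_sum_support_C_mul_X_pow]
  simp only [map_sum, map_mul, map_pow, Bivariate.equivMvPolynomial_C_C,
    Bivariate.equivMvPolynomial_C_X, Finset.sum_mul, mul_assoc]

theorem degreeOf_zero_equivMvPolynomial_le (q : F[X][Y]) :
    (Bivariate.equivMvPolynomial F q).degreeOf 0 ≤ (Bivariate.swap q).natDegree := by
  rw [equivMvPolynomial_eq_sum]
  refine (MvPolynomial.degreeOf_sum_le _ _ _).trans (Finset.sup_le fun k _ => ?_)
  refine (MvPolynomial.degreeOf_sum_le _ _ _).trans (Finset.sup_le fun l hl => ?_)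
  refine (MvPolynomial.degreeOf_C_mul_le _ _ _).trans
    ((MvPolynomial.degreeOf_mul_le _ _ _).trans ?_)
  rw [MvPolynomial.degreeOf_X_self_pow, MvPolynomial.degreeOf_X_pow_of_ne _ (by decide), add_zero]
  exact (le_natDegree_of_mem_supp l hl).trans (natDegree_coeff_le_natDegree_swap q k)

theorem degreeOf_one_equivMvPolynomial_le (q : F[X][Y]) :
    (Bivariate.equivMvPolynomial F q).degreeOf 1 ≤ q.natDegree := by
  rw [equivMvPolynomial_eq_sum]
  refine (MvPolynomial.degreeOf_sum_le _ _ _).trans (Finset.sup_le fun k hk => ?_)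
  refine (MvPolynomial.degreeOf_sum_le _ _ _).trans (Finset.sup_le fun l _ => ?_)
  refine (MvPolynomial.degreeOf_C_mul_le _ _ _).trans
    ((MvPolynomial.degreeOf_mul_le _ _ _).trans ?_)
  rw [MvPolynomial.degreeOf_X_self_pow, MvPolynomial.degreeOf_X_pow_of_ne _ (by decide), zero_add]
  exact le_natDegree_of_mem_supp k hk

theorem card_mul_card_le_of_card_filter_le {α β : Type*} [Fintype α] [Fintype β]
    [DecidableEq α] [DecidableEq β] (P : α → β → Prop) [∀ i j, Decidable (P i j)]
    (A : Finset α) (B : Finset β) {d : ℕ}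
    (h : ∀ i ∈ A, (Finset.univ.filter fun j => j ∉ B ∧ ¬ P i j).card ≤ d) :
    A.card * Fintype.card β ≤ A.card * (B.card + d) +
      (Finset.univ.filter fun z : α × β => P z.1 z.2 ∧ z.1 ∈ A ∧ z.2 ∉ B).card := by
  have hfiber : (Finset.univ.filter fun z : α × β => P z.1 z.2 ∧ z.1 ∈ A ∧ z.2 ∉ B) =
      (A ×ˢ Finset.univ).filter fun z : α × β => P z.1 z.2 ∧ z.2 ∉ B := by
    ext z
    simp
    tauto
  rw [hfiber, Finset.card_filter, Finset.sum_product]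
  simp only [← Finset.card_filter]
  rw [← smul_eq_mul, ← smul_eq_mul, ← Finset.sum_const, ← Finset.sum_const,
    ← Finset.sum_add_distrib]
  refine Finset.sum_le_sum fun i hi => ?_
  have hcover : (Finset.univ : Finset β) ⊆ (B ∪ Finset.univ.filter fun j => j ∉ B ∧ ¬ P i j) ∪
      Finset.univ.filter fun j => P i j ∧ j ∉ B := by
    intro j _
    simp
    tauto
  have h1 := Finset.card_le_card hcover
  have h2 := Finset.card_union_le (B ∪ Finset.univ.filter fun j => j ∉ B ∧ ¬ P i j)
    (Finset.univ.filter fun j => P i j ∧ j ∉ B)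
  have h3 := Finset.card_union_le B (Finset.univ.filter fun j => j ∉ B ∧ ¬ P i j)
  have h4 := h i hi
  rw [Finset.card_univ] at h1
  omega

theorem card_eval_eq_le {f g : F[X]} {d : ℕ} (hf : f.natDegree ≤ d) (hg : g.natDegree ≤ d)
    (h : f ≠ g) (s : Finset F) (hs : ∀ x ∈ s, f.eval x = g.eval x) : s.card ≤ d := by
  by_contra! hlt
  exact h (eq_of_natDegree_lt_card_of_eval_eq' f g s hs ((max_le hf hg).trans_lt hlt))

variable [Fintype F] [DecidableEq F]

theorem card_bad_rows_add_card_bad_columns_le {r c : F → F[X]} {q : F[X][Y]} {d : ℕ}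
    (hr : ∀ i, (r i).natDegree ≤ d) (hc : ∀ j, (c j).natDegree ≤ d)
    (hq : q.natDegree ≤ d) (hqs : (Bivariate.swap q).natDegree ≤ d) {A B : Finset F}
    (hA : ∀ i, i ∈ A ↔ r i ≠ q.map (evalRingHom i)) (hB : ∀ j, j ∈ B ↔ c j ≠ q.eval (C j)) :
    (A.card + B.card) * Fintype.card F ≤ 2 * (A.card * B.card) + (A.card + B.card) * d +
      (Finset.univ.filter fun z : F × F => (r z.1).eval z.2 ≠ (c z.2).eval z.1).card := by
  have hrows := card_mul_card_le_of_card_filter_le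
    (fun i j => (r i).eval j ≠ (c j).eval i) A B (d := d) (by
      intro i hi
      refine card_eval_eq_le (hr i) (natDegree_map_le.trans hq) ((hA i).1 hi) _ fun j hj => ?_
      simp only [Finset.mem_filter, Finset.mem_univ, true_and, hB, not_not] at hj
      rw [hj.2, map_evalRingHom_eval, evalEval, hj.1])
  have hcols := card_mul_card_le_of_card_filter_le
    (fun j i => (r i).eval j ≠ (c j).eval i) B A (d := d) (by
      intro j hj
      refine card_eval_eq_le (hc j) (g := q.eval (C j)) ?_ ((hB j).1 hj) _ fun i hi => ?_
      · rw [← map_eval_swap]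
        exact natDegree_map_le.trans hqs
      · simp only [Finset.mem_filter, Finset.mem_univ, true_and, hA, not_not] at hi
        rw [← hi.2, hi.1, map_evalRingHom_eval])
  have hswap : (Finset.univ.filter fun z : F × F =>
        (r z.2).eval z.1 ≠ (c z.1).eval z.2 ∧ z.1 ∈ B ∧ z.2 ∉ A).card =
      (Finset.univ.filter fun z : F × F =>
        (r z.1).eval z.2 ≠ (c z.2).eval z.1 ∧ z.2 ∈ B ∧ z.1 ∉ A).card :=
    Finset.card_equiv (Equiv.prodComm F F) (by simp)
  have hdisj : Disjoint
      (Finset.univ.filter fun z : F × F =>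
        (r z.1).eval z.2 ≠ (c z.2).eval z.1 ∧ z.1 ∈ A ∧ z.2 ∉ B)
      (Finset.univ.filter fun z : F × F =>
        (r z.1).eval z.2 ≠ (c z.2).eval z.1 ∧ z.2 ∈ B ∧ z.1 ∉ A) := by
    refine Finset.disjoint_filter.2 fun z _ h1 h2 => h2.2.2 h1.2.1
  have hsub := Finset.card_le_card (Finset.union_subset
    (Finset.monotone_filter_right (Finset.univ : Finset (F × F))
      (fun z _ (h : (r z.1).eval z.2 ≠ (c z.2).eval z.1 ∧ z.1 ∈ A ∧ z.2 ∉ B) => h.1))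
    (Finset.monotone_filter_right (Finset.univ : Finset (F × F))
      (fun z _ (h : (r z.1).eval z.2 ≠ (c z.2).eval z.1 ∧ z.2 ∈ B ∧ z.1 ∉ A) => h.1)))
  rw [Finset.card_union_of_disjoint hdisj, ← hswap] at hsub
  linarith

/-- The Polishchuk-Spielman lemma, with agreement on at least half of the rows and columns. -/
theorem exists_bivariate_of_card_lt {r c : F → F[X]} {d e : ℕ}
    (hr : ∀ i, (r i).natDegree ≤ d) (hc : ∀ j, (c j).natDegree ≤ d)
    (he : 2 * e + 2 * d < Fintype.card F)
    (hS : (Finset.univ.filter fun z : F × F =>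
      (r z.1).eval z.2 ≠ (c z.2).eval z.1).card < (e + 1) ^ 2) :
    ∃ q : F[X][Y], q.natDegree ≤ d ∧ (Bivariate.swap q).natDegree ≤ d ∧
      (Finset.univ.filter fun i => r i ≠ q.map (evalRingHom i)).card ≤ e ∧
      (Finset.univ.filter fun j => c j ≠ q.eval (C j)).card ≤ e := by
  obtain ⟨p, hp, hpe, hpse, hpS⟩ := exists_ne_zero_evalEval_eq_zero _ hS
  obtain ⟨q, hq, hqs, hrows, hcols⟩ := exists_interpolant (p := p) hr hc (by omega) (by omega)
    fun i j => by
      by_cases hij : (r i).eval j = (c j).eval i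
      · rw [hij]
      · rw [hpS (i, j) (by simpa using hij), zero_mul, zero_mul]
  obtain ⟨Q, rfl⟩ := dvd_of_rows_of_columns hp hq hqs (by omega) (by omega)
    (fun i => ⟨r i, hr i, hrows i⟩) (fun j => ⟨c j, hc j, hcols j⟩)
  refine ⟨Q, ?_, ?_, ?_, ?_⟩
  · rcases eq_or_ne Q 0 with rfl | h0
    · simp
    · rw [natDegree_mul hp h0] at hq
      omega
  · rcases eq_or_ne Q 0 with rfl | h0
    · simp
    · rw [map_mul, natDegree_mul (swap_ne_zero hp) (swap_ne_zero h0)] at hqs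
      omega
  · refine (Finset.card_le_card (Finset.monotone_filter_right _ fun i _ hi => ?_)).trans
      ((card_filter_map_eval_eq_zero_le hp).trans hpse)
    by_contra h0
    have := hrows i
    rw [Polynomial.map_mul] at this
    exact hi (mul_left_cancel₀ h0 this).symm
  · refine (Finset.card_le_card (Finset.monotone_filter_right _ fun j _ hj => ?_)).trans
      ((card_filter_map_eval_eq_zero_le (swap_ne_zero hp)).trans
        (by rwa [Bivariate.swap_swap_apply]))
    rw [map_eval_swap]
    by_contra h0
    have := hcols j
    rw [eval_mul] at this
    exact hj (mul_left_cancel₀ h0 this).symm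

theorem exists_const_column {r c : F → F[X]}
    (hr : ∀ i, (r i).natDegree ≤ 0) (hc : ∀ j, (c j).natDegree ≤ 0)
    (hS : 4 * (Finset.univ.filter fun z : F × F =>
      (r z.1).eval z.2 ≠ (c z.2).eval z.1).card ≤ Fintype.card F ^ 2) :
    ∃ v : F, 4 * (Finset.univ.filter fun i => r i ≠ C v).card ≤ Fintype.card F := by
  obtain ⟨j, -, hj⟩ := Finset.exists_le_of_sum_le (s := (Finset.univ : Finset F))
    (f := fun j => 4 * (Finset.univ.filter fun i => (r i).eval j ≠ (c j).eval i).card)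
    (g := fun _ => Fintype.card F) Finset.univ_nonempty (by
      rw [← Finset.mul_sum, Finset.sum_const, Finset.card_univ, smul_eq_mul, ← sq]
      refine le_trans (le_of_eq ?_) hS
      simp only [Finset.card_filter, Fintype.sum_prod_type_right])
  refine ⟨(c j).coeff 0, le_trans ?_ hj⟩
  refine Nat.mul_le_mul_left 4 (Finset.card_le_card
    (Finset.monotone_filter_right _ fun i _ hi h => hi ?_))
  rw [eq_C_of_natDegree_le_zero (hr i), eq_C_of_natDegree_le_zero (hc j), eval_C, eval_C] at h
  rw [eq_C_of_natDegree_le_zero (hr i), h]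

theorem le_quarter_of_add_mul_le {a b d n s : ℝ} (hn : 0 < n) (ha : 2 * a ≤ n) (hb0 : 0 ≤ b)
    (hb : 2 * b ≤ n) (hd : 0 ≤ d)
    (hs : s ≤ n ^ 2 / 4 - d * n) (h : (a + b) * n ≤ 2 * (a * b) + (a + b) * d + s) :
    a ≤ n / 4 := by
  have h1 : 0 ≤ b * (n - 2 * a) := mul_nonneg hb0 (by linarith)
  have h2 : 0 ≤ d * (n - a - b) := mul_nonneg hd (by linarith)
  have h3 : n * a ≤ n * (n / 4) := by nlinarith
  exact le_of_mul_le_mul_left h3 hn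

theorem exists_bivariate_of_card_le {r c : F → F[X]} {d : ℕ}
    (hr : ∀ i, (r i).natDegree ≤ d) (hc : ∀ j, (c j).natDegree ≤ d)
    (hS : ((Finset.univ.filter fun z : F × F =>
      (r z.1).eval z.2 ≠ (c z.2).eval z.1).card : ℝ) ≤
        (Fintype.card F : ℝ) ^ 2 / 4 - d * Fintype.card F) :
    ∃ q : F[X][Y], q.natDegree ≤ d ∧ (Bivariate.swap q).natDegree ≤ d ∧
      ((Finset.univ.filter fun i => r i ≠ q.map (evalRingHom i)).card : ℝ) ≤
        (Fintype.card F : ℝ) / 4 ∧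
      ((Finset.univ.filter fun j => c j ≠ q.eval (C j)).card : ℝ) ≤
        (Fintype.card F : ℝ) / 4 := by
  have hn : (0 : ℝ) < Fintype.card F := by exact_mod_cast Fintype.card_pos
  set n : ℝ := (Fintype.card F : ℝ) with hndef
  have hbound (q : F[X][Y]) (hq : q.natDegree ≤ d) (hqs : (Bivariate.swap q).natDegree ≤ d) :
      ((Finset.univ.filter fun i => r i ≠ q.map (evalRingHom i)).card +
        (Finset.univ.filter fun j => c j ≠ q.eval (C j)).card : ℝ) * n ≤
      2 * ((Finset.univ.filter fun i => r i ≠ q.map (evalRingHom i)).card *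
        (Finset.univ.filter fun j => c j ≠ q.eval (C j)).card : ℝ) +
      ((Finset.univ.filter fun i => r i ≠ q.map (evalRingHom i)).card +
        (Finset.univ.filter fun j => c j ≠ q.eval (C j)).card : ℝ) * d +
      (Finset.univ.filter fun z : F × F => (r z.1).eval z.2 ≠ (c z.2).eval z.1).card := by
    have := card_bad_rows_add_card_bad_columns_le hr hc hq hqs
      (A := Finset.univ.filter fun i => r i ≠ q.map (evalRingHom i))
      (B := Finset.univ.filter fun j => c j ≠ q.eval (C j)) (by simp) (by simp)
    rw [hndef]
    exact_mod_cast this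
  rcases Nat.eq_zero_or_pos d with rfl | hd
  · obtain ⟨v, hv⟩ := exists_const_column hr hc (by
      have : 4 * ((Finset.univ.filter fun z : F × F =>
        (r z.1).eval z.2 ≠ (c z.2).eval z.1).card : ℝ) ≤ n ^ 2 := by
        simp only [Nat.cast_zero, zero_mul, sub_zero] at hS
        linarith
      rw [hndef] at this
      exact_mod_cast this)
    have h := hbound (C (C v)) (by simp) (by rw [Bivariate.swap_C_C]; simp)
    have hmap (i : F) : (C (C v) : F[X][Y]).map (evalRingHom i) = C v := by simp
    simp only [hmap] at h
    have hvR : 4 * ((Finset.univ.filter fun i => r i ≠ C v).card : ℝ) ≤ n := by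
      rw [hndef]
      exact_mod_cast hv
    refine ⟨C (C v), by simp, by rw [Bivariate.swap_C_C]; simp, ?_, ?_⟩
    · simp only [hmap]
      linarith
    · set a : ℝ := ((Finset.univ.filter fun i => r i ≠ C v).card : ℝ)
      set b : ℝ :=
        ((Finset.univ.filter fun j => c j ≠ (C (C v) : F[X][Y]).eval (C j)).card : ℝ)
      have ha : 0 ≤ a := Nat.cast_nonneg _
      simp only [Nat.cast_zero, zero_mul, mul_zero, add_zero, sub_zero] at h hS
      have h1 : (n - 2 * a) * b ≤ (n - 2 * a) * (n / 4) := by nlinarith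
      exact le_of_mul_le_mul_left h1 (by linarith)
  · set s := (Finset.univ.filter fun z : F × F => (r z.1).eval z.2 ≠ (c z.2).eval z.1).card
    have hdR : (0 : ℝ) < d := by exact_mod_cast hd
    have hsR : (0 : ℝ) ≤ s := Nat.cast_nonneg _
    have h4d : 4 * (d : ℝ) ≤ n := by
      have : n * (4 * d) ≤ n * n := by nlinarith
      exact le_of_mul_le_mul_left this hn
    have hsq : (Nat.sqrt s : ℝ) ^ 2 ≤ s := by exact_mod_cast Nat.sqrt_le' s
    have he : 2 * Nat.sqrt s + 2 * d < Fintype.card F := by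
      have : 2 * (Nat.sqrt s : ℝ) < n - 2 * d := by
        refine lt_of_pow_lt_pow_left₀ 2 (by linarith) ?_
        nlinarith
      have : 2 * (Nat.sqrt s : ℝ) + 2 * d < n := by linarith
      rw [hndef] at this
      exact_mod_cast this
    obtain ⟨q, hq, hqs, hA, hB⟩ := exists_bivariate_of_card_lt hr hc he (Nat.lt_succ_sqrt' s)
    have h := hbound q hq hqs
    have half {k : ℕ} (hk : k ≤ Nat.sqrt s) : 2 * (k : ℝ) ≤ n := by
      rw [hndef]
      exact_mod_cast (by omega : 2 * k ≤ Fintype.card F)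
    refine ⟨q, hq, hqs, ?_, ?_⟩
    · exact le_quarter_of_add_mul_le hn (half hA) (Nat.cast_nonneg _) (half hB) hdR.le hS h
    · exact le_quarter_of_add_mul_le hn (half hB) (Nat.cast_nonneg _) (half hA) hdR.le hS
        (by linarith)
end

/-- There is an absolute constant `C > 0` such that for any finite
field `F`, `d ≥ 0`, and `ε ≥ C·d/|F|`: if `(r_i)` and `(c_j)` are families of
univariate polynomials of degree at most `d` with the fraction of pairs `(i,j)` where
`r_i(j) ≠ c_j(i)` at most `1/4 - ε`, then there is a bivariate polynomial `Q` of
degree at most `d` in each variable such that `r_i(Y) = Q(i,Y)` for all but at most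
`|F|/4` of the `i`'s, and `c_j(X) = Q(X,j)` for all but at most `|F|/4` of the
`j`'s. -/
theorem row_col_agreement :
    ∃ C : ℝ, 0 < C ∧
    ∀ (F : Type) [Field F] [Fintype F] [DecidableEq F] (d : ℕ) (ε : ℝ),
      C * (d : ℝ) / (Fintype.card F : ℝ) ≤ ε →
      ∀ r c : F → Polynomial F,
        (∀ i, (r i).natDegree ≤ d) → (∀ j, (c j).natDegree ≤ d) →
        ((Finset.univ.filter fun z : F × F =>
            (r z.1).eval z.2 ≠ (c z.2).eval z.1).card : ℝ) /
          (Fintype.card F : ℝ) ^ 2 ≤ 1 / 4 - ε →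
      ∃ Q : MvPolynomial (Fin 2) F,
        Q.degreeOf 0 ≤ d ∧ Q.degreeOf 1 ≤ d ∧
        ((Finset.univ.filter fun i : F =>
            r i ≠ MvPolynomial.aeval ![Polynomial.C i, Polynomial.X] Q).card : ℝ) ≤
          (Fintype.card F : ℝ) / 4 ∧
        ((Finset.univ.filter fun j : F =>
            c j ≠ MvPolynomial.aeval ![Polynomial.X, Polynomial.C j] Q).card : ℝ) ≤
          (Fintype.card F : ℝ) / 4 := by
  refine ⟨1, one_pos, fun F _ _ _ d ε hε r c hr hc hS => ?_⟩
  have hn : (0 : ℝ) < Fintype.card F := by exact_mod_cast Fintype.card_pos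
  rw [one_mul, div_le_iff₀ hn] at hε
  rw [div_le_iff₀ (by positivity)] at hS
  obtain ⟨q, hq, hqs, hA, hB⟩ := exists_bivariate_of_card_le hr hc (hS.trans (by nlinarith))
  refine ⟨Polynomial.Bivariate.equivMvPolynomial F q,
    (degreeOf_zero_equivMvPolynomial_le q).trans hqs,
    (degreeOf_one_equivMvPolynomial_le q).trans hq, ?_, ?_⟩
  · simpa only [aeval_equivMvPolynomial_C_X] using hA
  · simpa only [aeval_equivMvPolynomial_X_C] using hB
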